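/- Let G = H ⋉ N with N a finitely generated abelian normal subgroup generated by {n_1,...,n_k}, and let {h_1,...,h_t} represent all conjugacy classes of H. Set S = {h_1,...,h_t, n_1,...,n_k, n_1⁻¹,...,n_k⁻¹}. For two finite-dimensional complex representations ρ₁, ρ₂ of G, the characteristic polynomials d(S,ρ₁) and d(S,ρ₂) are equal if and only if ρ₁ and ρ₂ are equivalent. -/

import Mathlib

open Matrix

section aux
variable {d : ℕ}

lemma aux_det_aeval (M M' : Matrix (Fin d) (Fin d) ℂ)
    (hM : ∀ x : ℂ, (x • (1 : Matrix (Fin d) (Fin d) ℂ) + M).det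
      = (x • (1 : Matrix (Fin d) (Fin d) ℂ) + M').det) (p : Polynomial ℂ) :
    (Polynomial.aeval M p).det = (Polynomial.aeval M' p).det := by
  have hp := (IsAlgClosed.splits p).eq_prod_roots
  have key : ∀ A : Matrix (Fin d) (Fin d) ℂ, (Polynomial.aeval A p).det
      = p.leadingCoeff ^ d * (p.roots.map fun r => ((-r) • (1 : Matrix (Fin d) (Fin d) ℂ) + A).det).prod := by
    intro A
    let φ : Polynomial ℂ →* ℂ := (Matrix.detMonoidHom (n := Fin d) (R := ℂ)).comp
      ((Polynomial.aeval A : Polynomial ℂ →ₐ[ℂ] Matrix (Fin d) (Fin d) ℂ) : Polynomial ℂ →* _)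
    have hφ : ∀ q, φ q = (Polynomial.aeval A q).det := fun q => rfl
    rw [← hφ]
    conv_lhs => rw [hp]
    rw [map_mul, map_multiset_prod, Multiset.map_map]
    congr 1
    · rw [hφ, Polynomial.aeval_C, Algebra.algebraMap_eq_smul_one, Matrix.det_smul]
      simp
    · congr 1
      apply Multiset.map_congr rfl
      intro r _
      simp only [Function.comp, hφ, map_sub, Polynomial.aeval_X, Polynomial.aeval_C,
        Algebra.algebraMap_eq_smul_one]
      congr 1
      rw [neg_smul]; abel
  rw [key, key]
  simp only [hM]

lemma aux_trace_pow (M M' : Matrix (Fin d) (Fin d) ℂ)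
    (hM : ∀ x : ℂ, (x • (1 : Matrix (Fin d) (Fin d) ℂ) + M).det
      = (x • (1 : Matrix (Fin d) (Fin d) ℂ) + M').det) (m : ℕ) :
    (M ^ m).trace = (M' ^ m).trace := by
  have : (M ^ m).charpoly = (M' ^ m).charpoly := by
    apply Polynomial.funext
    intro x
    rw [Matrix.eval_charpoly, Matrix.eval_charpoly]
    have := aux_det_aeval M M' hM (Polynomial.C x - Polynomial.X ^ m)
    simpa [Polynomial.aeval_C, Matrix.algebraMap_eq_diagonal, Matrix.scalar_apply, Pi.algebraMap_def]
      using this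
  rw [Matrix.trace_eq_sum_roots_charpoly, Matrix.trace_eq_sum_roots_charpoly, this]

attribute [local instance] Matrix.linftyOpNormedRing Matrix.linftyOpNormedAlgebra

lemma aux_deriv (Q A B : Matrix (Fin d) (Fin d) ℂ) (m : ℕ)
    (h : Q = 1 ∨ Commute A B) :
    HasDerivAt (fun e : ℂ => (Q * (A + e • B) ^ (m + 1)).trace)
      ((m + 1 : ℂ) * (Q * B * A ^ m).trace) 0 := by
  have h1 : HasDerivAt (fun e : ℂ => A + e • B) B 0 := by
    exact (((hasDerivAt_id (0 : ℂ)).smul_const B).const_add A).congr_deriv (one_smul ℂ B)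
  have h2 := (h1.fun_pow' (m + 1)).const_mul Q
  let T : Matrix (Fin d) (Fin d) ℂ →L[ℂ] ℂ :=
    LinearMap.toContinuousLinearMap (Matrix.traceLinearMap (Fin d) ℂ ℂ)
  have h3 := T.hasFDerivAt.comp_hasDerivAt (0 : ℂ) h2
  refine h3.congr_deriv ?_
  change (Q * _).trace = _
  rw [Finset.mul_sum, Matrix.trace_sum]
  have : ∀ i ∈ Finset.range (m + 1),
      (Q * ((A + (0 : ℂ) • B) ^ ((m + 1).pred - i) * B * (A + (0 : ℂ) • B) ^ i)).trace
        = (Q * B * A ^ m).trace := by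
    intro i hi
    have hi' : m - i + i = m := by have := Finset.mem_range.1 hi; omega
    simp only [zero_smul, add_zero, Nat.pred_succ]
    rcases h with rfl | h
    · rw [one_mul, one_mul, mul_assoc, Matrix.trace_mul_comm, mul_assoc, ← pow_add, add_comm, hi']
    · rw [(h.pow_left _).eq, mul_assoc, ← pow_add, hi', mul_assoc]
  rw [Finset.sum_congr rfl this]
  simp

lemma aux_step (Q A B Q' A' B' : Matrix (Fin d) (Fin d) ℂ) (m : ℕ)
    (h : Q = 1 ∨ Commute A B) (h' : Q' = 1 ∨ Commute A' B')
    (heq : ∀ e : ℂ, (Q * (A + e • B) ^ (m + 1)).trace = (Q' * (A' + e • B') ^ (m + 1)).trace) :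
    (Q * B * A ^ m).trace = (Q' * B' * A' ^ m).trace := by
  have h1 := aux_deriv Q A B m h
  have h2 := aux_deriv Q' A' B' m h'
  rw [funext heq] at h1
  exact mul_left_cancel₀ (Nat.cast_add_one_ne_zero m) (h1.unique h2)

end aux

/-- The commuting pencil. -/
noncomputable def auxA {G : Type*} [Group G] {k d : ℕ} (n : Fin k → G)
    (ρ : G →* (Matrix (Fin d) (Fin d) ℂ)ˣ) (z w : Fin k → ℂ) : Matrix (Fin d) (Fin d) ℂ :=
  ∑ j, z j • (ρ (n j) : Matrix (Fin d) (Fin d) ℂ)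
    + ∑ j, w j • (ρ ((n j)⁻¹) : Matrix (Fin d) (Fin d) ℂ)

lemma auxA_add_z {G : Type*} [Group G] {k d : ℕ} (n : Fin k → G)
    (ρ : G →* (Matrix (Fin d) (Fin d) ℂ)ˣ) (z w : Fin k → ℂ) (j : Fin k) (e : ℂ) :
    auxA n ρ z w + e • (ρ (n j) : Matrix (Fin d) (Fin d) ℂ) = auxA n ρ (z + Pi.single j e) w := by
  simp only [auxA, Pi.add_apply, add_smul, Finset.sum_add_distrib]
  have : ∑ x, (Pi.single j e : Fin k → ℂ) x • (ρ (n x) : Matrix (Fin d) (Fin d) ℂ)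
      = e • (ρ (n j) : Matrix (Fin d) (Fin d) ℂ) := by
    rw [Finset.sum_eq_single j] <;> simp +contextual [Pi.single_apply]
  rw [this]; abel

lemma auxA_add_w {G : Type*} [Group G] {k d : ℕ} (n : Fin k → G)
    (ρ : G →* (Matrix (Fin d) (Fin d) ℂ)ˣ) (z w : Fin k → ℂ) (j : Fin k) (e : ℂ) :
    auxA n ρ z w + e • (ρ ((n j)⁻¹) : Matrix (Fin d) (Fin d) ℂ)
      = auxA n ρ z (w + Pi.single j e) := by
  simp only [auxA, Pi.add_apply, add_smul, Finset.sum_add_distrib]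
  have : ∑ x, (Pi.single j e : Fin k → ℂ) x • (ρ ((n x)⁻¹) : Matrix (Fin d) (Fin d) ℂ)
      = e • (ρ ((n j)⁻¹) : Matrix (Fin d) (Fin d) ℂ) := by
    rw [Finset.sum_eq_single j] <;> simp +contextual [Pi.single_apply]
  rw [this]; abel

lemma auxA_commute {G : Type*} [Group G] {k d : ℕ} (n : Fin k → G)
    (ρ : G →* (Matrix (Fin d) (Fin d) ℂ)ˣ) (z w : Fin k → ℂ) (g : G)
    (hg : ∀ j, Commute (n j) g) :
    Commute (auxA n ρ z w) (ρ g : Matrix (Fin d) (Fin d) ℂ) := by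
  have key : ∀ x : G, Commute x g → Commute (ρ x : Matrix (Fin d) (Fin d) ℂ) (ρ g) := by
    intro x hx
    have := hx.map ρ
    exact this.map (Units.coeHom _)
  refine Commute.add_left ?_ ?_
  · exact Commute.sum_left _ _ _ fun j _ => (key _ (hg j)).smul_left _
  · exact Commute.sum_left _ _ _ fun j _ => (key _ (hg j).inv_left).smul_left _

/-- For `G = H ⋉ N` (`N` abelian, generated by `n₁,…,n_k`; `h₁,…,h_t` representatives of the
conjugacy classes of `H`) and the generating set
`S = {h₁,…,h_t, n₁,…,n_k, n₁⁻¹,…,n_k⁻¹}`, two finite-dimensional complex representations of `G`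
have equal characteristic polynomials `d(S,ρ)` if and only if they are equivalent (given that
equality of characters implies equivalence). -/
theorem stmt10 {G : Type*} [Group G] (H N : Subgroup G) [N.Normal]
    (hab : ∀ a b : G, a ∈ N → b ∈ N → a * b = b * a)
    (hcomp : H.IsComplement' N)
    {t k d : ℕ} (h : Fin t → H) (hrep : ∀ x : H, ∃ i, IsConj (h i) x)
    (n : Fin k → G) (hn : Subgroup.closure (Set.range n) = N)
    (ρ₁ ρ₂ : G →* (Matrix (Fin d) (Fin d) ℂ)ˣ)
    (hchar : (∀ g : G, (ρ₁ g : Matrix (Fin d) (Fin d) ℂ).trace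
          = (ρ₂ g : Matrix (Fin d) (Fin d) ℂ).trace) →
        ∃ X : (Matrix (Fin d) (Fin d) ℂ)ˣ, ∀ g : G,
          (ρ₂ g : Matrix (Fin d) (Fin d) ℂ)
            = (↑(X⁻¹) : Matrix (Fin d) (Fin d) ℂ) * (↑(ρ₁ g) : Matrix (Fin d) (Fin d) ℂ) * (X : Matrix (Fin d) (Fin d) ℂ)) :
    (∀ (x₀ : ℂ) (y : Fin t → ℂ) (z w : Fin k → ℂ),
        (x₀ • (1 : Matrix (Fin d) (Fin d) ℂ)
            + ∑ i, y i • (ρ₁ (h i : G) : Matrix (Fin d) (Fin d) ℂ)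
            + ∑ j, z j • (ρ₁ (n j) : Matrix (Fin d) (Fin d) ℂ)
            + ∑ j, w j • (ρ₁ ((n j)⁻¹) : Matrix (Fin d) (Fin d) ℂ)).det
          = (x₀ • (1 : Matrix (Fin d) (Fin d) ℂ)
            + ∑ i, y i • (ρ₂ (h i : G) : Matrix (Fin d) (Fin d) ℂ)
            + ∑ j, z j • (ρ₂ (n j) : Matrix (Fin d) (Fin d) ℂ)
            + ∑ j, w j • (ρ₂ ((n j)⁻¹) : Matrix (Fin d) (Fin d) ℂ)).det)
      ↔ ∃ X : (Matrix (Fin d) (Fin d) ℂ)ˣ, ∀ g : G,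
          (ρ₂ g : Matrix (Fin d) (Fin d) ℂ)
            = (↑(X⁻¹) : Matrix (Fin d) (Fin d) ℂ) * (↑(ρ₁ g) : Matrix (Fin d) (Fin d) ℂ) * (X : Matrix (Fin d) (Fin d) ℂ) := by
  constructor
  · intro hd
    apply hchar
    have hnN : ∀ j, n j ∈ N := fun j => hn ▸ Subgroup.subset_closure ⟨j, rfl⟩
    have hc1 : ∀ i j, Commute (n i) (n j) := fun i j => hab _ _ (hnN i) (hnN j)
    have base : ∀ (i : Fin t) (m : ℕ) (z w : Fin k → ℂ),
        ((ρ₁ (h i : G) : Matrix (Fin d) (Fin d) ℂ) * auxA n ρ₁ z w ^ m).trace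
          = ((ρ₂ (h i : G) : Matrix (Fin d) (Fin d) ℂ) * auxA n ρ₂ z w ^ m).trace := by
      intro i m z w
      have := aux_step 1 (auxA n ρ₁ z w) (ρ₁ (h i : G)) 1 (auxA n ρ₂ z w) (ρ₂ (h i : G)) m
        (Or.inl rfl) (Or.inl rfl) ?_
      · simpa using this
      intro e
      rw [one_mul, one_mul]
      apply aux_trace_pow
      intro x
      have hx := hd x (Pi.single i e) z w
      have hs : ∀ ρ : G →* (Matrix (Fin d) (Fin d) ℂ)ˣ,
          ∑ a, (Pi.single i e : Fin t → ℂ) a • (ρ (h a : G) : Matrix (Fin d) (Fin d) ℂ)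
          = e • (ρ (h i : G) : Matrix (Fin d) (Fin d) ℂ) := by
        intro ρ
        rw [Finset.sum_eq_single i] <;> simp +contextual [Pi.single_apply]
      rw [hs, hs] at hx
      convert hx using 2 <;> simp only [auxA] <;> abel
    have main : ∀ (i : Fin t) (g : G), g ∈ Subgroup.closure (Set.range n) →
        ∀ (m : ℕ) (z w : Fin k → ℂ),
        ((ρ₁ (h i * g : G) : Matrix (Fin d) (Fin d) ℂ) * auxA n ρ₁ z w ^ m).trace
          = ((ρ₂ (h i * g : G) : Matrix (Fin d) (Fin d) ℂ) * auxA n ρ₂ z w ^ m).trace := by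
      intro i g hg
      induction hg using Subgroup.closure_induction_right with
      | one => simpa using base i
      | mul_right x hx y hy ih =>
        obtain ⟨j, rfl⟩ := hy
        intro m z w
        have := aux_step (ρ₁ (h i * x : G)) (auxA n ρ₁ z w) (ρ₁ (n j))
          (ρ₂ (h i * x : G)) (auxA n ρ₂ z w) (ρ₂ (n j)) m
          (Or.inr (auxA_commute _ _ _ _ _ fun a => hc1 a j))
          (Or.inr (auxA_commute _ _ _ _ _ fun a => hc1 a j)) ?_
        · rw [← mul_assoc, map_mul, map_mul ρ₂, Units.val_mul, Units.val_mul]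
          exact this
        intro e
        rw [auxA_add_z, auxA_add_z]
        exact ih _ _ _
      | mul_inv_cancel x hx y hy ih =>
        obtain ⟨j, rfl⟩ := hy
        intro m z w
        have := aux_step (ρ₁ (h i * x : G)) (auxA n ρ₁ z w) (ρ₁ (n j)⁻¹)
          (ρ₂ (h i * x : G)) (auxA n ρ₂ z w) (ρ₂ (n j)⁻¹) m
          (Or.inr (auxA_commute _ _ _ _ _ fun a => (hc1 a j).inv_right))
          (Or.inr (auxA_commute _ _ _ _ _ fun a => (hc1 a j).inv_right)) ?_
        · rw [← mul_assoc, map_mul, map_mul ρ₂, Units.val_mul, Units.val_mul]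
          exact this
        intro e
        rw [auxA_add_w, auxA_add_w]
        exact ih _ _ _
    intro g
    obtain ⟨⟨a, b⟩, rfl⟩ := hcomp.2 g
    obtain ⟨i, hi⟩ := hrep a
    obtain ⟨c, hc⟩ := isConj_iff.1 hi
    have hmem : (c : G)⁻¹ * b * c ∈ Subgroup.closure (Set.range n) := by
      rw [hn]
      simpa using (inferInstance : N.Normal).conj_mem b b.2 (c : G)⁻¹
    have e1 : (a : G) * b = c * (h i * ((c : G)⁻¹ * b * c)) * (c : G)⁻¹ := by
      rw [← hc]; push_cast; group
    have ht : ∀ ρ : G →* (Matrix (Fin d) (Fin d) ℂ)ˣ,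
        (ρ ((a : G) * b) : Matrix (Fin d) (Fin d) ℂ).trace
          = (ρ (h i * ((c : G)⁻¹ * b * c)) : Matrix (Fin d) (Fin d) ℂ).trace := by
      intro ρ
      rw [e1, map_mul, map_mul ρ (c : G), map_inv, Units.val_mul, Units.val_mul,
        Matrix.trace_units_conj]
    have := main i _ hmem 0 0 0
    simp only [pow_zero, mul_one] at this
    change (ρ₁ ((a : G) * b) : Matrix (Fin d) (Fin d) ℂ).trace
      = (ρ₂ ((a : G) * b) : Matrix (Fin d) (Fin d) ℂ).trace
    rw [ht, ht, this]
  · rintro ⟨X, hX⟩ x₀ y z w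
    rw [← Matrix.det_units_conj' X]
    congr 1
    simp only [hX, mul_add, add_mul, Finset.mul_sum, Finset.sum_mul, mul_smul_comm, smul_mul_assoc,
      mul_one, Units.inv_mul]
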